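/- (Semantic validity of SP) For all modal formulas φ, ψ, ψ' and every propositional variable x, the formula (ψ≡ψ')→(φ[x:=ψ]≡φ[x:=ψ']) is valid, i.e., satisfied by every interpretation (M,γ). -/

import Mathlib

/-- Modal formulas over countably many propositional variables x₀, x₁, …. -/
inductive Fm : Type
  | var : ℕ → Fm
  | neg : Fm → Fm
  | imp : Fm → Fm → Fm
  | box : Fm → Fm
deriving DecidableEq

namespace Fm

/-- ⊤ := x₀ → x₀ -/
def top : Fm := imp (var 0) (var 0)

/-- φ ∧ ψ := ¬(φ → ¬ψ) -/
def conj (φ ψ : Fm) : Fm := neg (imp φ (neg ψ))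

/-- φ ↔ ψ := (φ → ψ) ∧ (ψ → φ) -/
def biimp (φ ψ : Fm) : Fm := conj (imp φ ψ) (imp ψ φ)

/-- strict equivalence: φ ≡ ψ := □(φ → ψ) ∧ □(ψ → φ) -/
def equiv (φ ψ : Fm) : Fm := conj (box (imp φ ψ)) (box (imp ψ φ))

/-- φ[x := ψ]: substitution of ψ for all occurrences of the variable x in φ. -/
def subst (φ : Fm) (x : ℕ) (ψ : Fm) : Fm :=
  match φ with
  | var y => if y = x then ψ else var y
  | neg χ => neg (subst χ x ψ)
  | imp χ δ => imp (subst χ x ψ) (subst δ x ψ)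
  | box χ => box (subst χ x ψ)

/-- Propositional (two-valued) evaluation of a modal formula, treating
variables and boxed formulas as atoms. -/
def pEval (v : Fm → Bool) : Fm → Bool
  | var n => v (var n)
  | neg φ => !(pEval v φ)
  | imp φ ψ => !(pEval v φ) || pEval v ψ
  | box φ => v (box φ)

/-- φ has the form of a propositional tautology, i.e. φ is a substitution
instance of a propositional tautology. -/
def isTautInstance (φ : Fm) : Prop := ∀ v : Fm → Bool, pEval v φ = true

/-- The axioms (i)–(iii) of Lewis system S1 (Lemmon-style). -/
inductive S1Axiom : Fm → Prop
  | taut {φ} : isTautInstance φ → S1Axiom φ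
  | ax2 (φ) : S1Axiom (imp (box φ) φ)
  | ax3 (φ ψ χ) :
      S1Axiom (imp (conj (box (imp φ ψ)) (box (imp ψ χ))) (box (imp φ χ)))

/-- The identity axioms (iv)–(vi), i.e. the Substitution Principle SP. -/
inductive SPAxiom : Fm → Prop
  | ax4 (φ ψ) : SPAxiom (imp (equiv φ ψ) (equiv (neg φ) (neg ψ)))
  | ax5 (φ ψ φ' ψ') :
      SPAxiom (imp (conj (equiv φ ψ) (equiv φ' ψ'))
        (equiv (imp φ φ') (imp ψ ψ')))
  | ax6 (φ ψ) : SPAxiom (imp (equiv φ ψ) (equiv (box φ) (box ψ)))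

/-- Derivability in S1+SP from a set Φ of premises: axioms (i)–(vi),
modus ponens, and Axiom Necessitation AN restricted to axioms (i)–(iii). -/
inductive S1SP : Set Fm → Fm → Prop
  | prem {Φ φ} : φ ∈ Φ → S1SP Φ φ
  | axm {Φ φ} : S1Axiom φ → S1SP Φ φ
  | spAxm {Φ φ} : SPAxiom φ → S1SP Φ φ
  | mp {Φ φ ψ} : S1SP Φ (imp φ ψ) → S1SP Φ φ → S1SP Φ ψ
  | an {Φ φ} : S1Axiom φ → S1SP Φ (box φ)

end Fm

/-- An algebraic model: a Boolean algebra (with complement `ᶜ` and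
implication `⇨`), a set TRUE of true propositions, and a unary operation f□,
satisfying the model conditions (1)–(6). -/
structure MModel where
  M : Type
  [ba : BooleanAlgebra M]
  TRUE : Set M
  fbox : M → M
  bot_not_true : ⊥ ∉ TRUE
  top_true : ⊤ ∈ TRUE
  compl_true : ∀ m : M, mᶜ ∈ TRUE ↔ m ∉ TRUE
  himp_true : ∀ m m' : M, (m ⇨ m') ∈ TRUE ↔ (m ∉ TRUE ∨ m' ∈ TRUE)
  fbox_true : ∀ m : M, fbox m ∈ TRUE ↔ m = ⊤
  fbox_le : ∀ m : M, fbox m ≤ m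
  fbox_trans : ∀ m m' m'' : M,
    fbox (m ⇨ m') ⊓ fbox (m' ⇨ m'') ≤ fbox (m ⇨ m'')

attribute [instance] MModel.ba

namespace MModel

/-- The canonical homomorphic extension of an assignment γ of propositions
to the variables. -/
def eval (𝓜 : MModel) (γ : ℕ → 𝓜.M) : Fm → 𝓜.M
  | .var n => γ n
  | .neg φ => (𝓜.eval γ φ)ᶜ
  | .imp φ ψ => 𝓜.eval γ φ ⇨ 𝓜.eval γ ψ
  | .box φ => 𝓜.fbox (𝓜.eval γ φ)

/-- Satisfaction: (𝓜, γ) ⊨ φ iff γ(φ) ∈ TRUE. -/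
def sat (𝓜 : MModel) (γ : ℕ → 𝓜.M) (φ : Fm) : Prop := 𝓜.eval γ φ ∈ 𝓜.TRUE

end MModel

theorem sat_equiv_iff (𝓜 : MModel) (γ : ℕ → 𝓜.M) (φ ψ : Fm) :
    𝓜.eval γ (Fm.equiv φ ψ) ∈ 𝓜.TRUE ↔ 𝓜.eval γ φ = 𝓜.eval γ ψ := by
  simp only [Fm.equiv, Fm.conj, MModel.eval, 𝓜.compl_true, 𝓜.himp_true, 𝓜.fbox_true,
    himp_eq_top_iff, not_or, not_not]
  exact le_antisymm_iff.symm

theorem eval_subst_congr (𝓜 : MModel) (γ : ℕ → 𝓜.M) (φ ψ ψ' : Fm) (x : ℕ)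
    (h : 𝓜.eval γ ψ = 𝓜.eval γ ψ') :
    𝓜.eval γ (Fm.subst φ x ψ) = 𝓜.eval γ (Fm.subst φ x ψ') := by
  induction φ with
  | var y =>
    simp only [Fm.subst]
    split_ifs
    · exact h
    · rfl
  | neg χ ih => simp only [Fm.subst, MModel.eval, ih]
  | imp χ δ ih1 ih2 => simp only [Fm.subst, MModel.eval, ih1, ih2]
  | box χ ih => simp only [Fm.subst, MModel.eval, ih]

open Fm in
/-- Semantic validity of the Substitution Principle SP. -/
theorem SP_valid (φ ψ ψ' : Fm) (x : ℕ) (𝓜 : MModel) (γ : ℕ → 𝓜.M) :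
    𝓜.sat γ (imp (equiv ψ ψ') (equiv (subst φ x ψ) (subst φ x ψ'))) := by
  refine (𝓜.himp_true _ _).mpr (or_iff_not_imp_left.mpr fun h => ?_)
  rw [not_not, sat_equiv_iff] at h
  exact (sat_equiv_iff _ _ _ _).mpr (eval_subst_congr 𝓜 γ φ ψ ψ' x h)
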